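/- Let V ∈ C²(ℝ^d) be convex with bounded Hessian. For h > 0, let J_h^V = (I + h∇V)^{-1} be the resolvent of V on ℝ^d. Then for every probability measure μ ∈ P₂(ℝ^d), the pushforward (J_h^V)_# μ is the unique minimizer over ν ∈ P₂(ℝ^d) of ν ↦ 𝒱(ν) + (1/(2h)) W₂²(μ, ν), where 𝒱(ν) = ∫ V dν; i.e., J_h^𝒱 μ = (J_h^V)_# μ. -/

import Mathlib

open MeasureTheory

/-- The (squared) `L²`-Wasserstein distance: infimum over couplings of the quadratic cost. -/
noncomputable def W2sq {E : Type*} [MeasurableSpace E] [NormedAddCommGroup E]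
    (μ ν : Measure E) : ENNReal :=
  ⨅ (σ : Measure (E × E)) (_ : σ.map Prod.fst = μ ∧ σ.map Prod.snd = ν),
    ∫⁻ p, (‖p.1 - p.2‖₊ : ENNReal) ^ 2 ∂σ

open Filter Topology

theorem W2sq_swap_le {E : Type*} [MeasurableSpace E] [NormedAddCommGroup E] [BorelSpace E]
    [SecondCountableTopology E] (μ ν : Measure E) : W2sq ν μ ≤ W2sq μ ν := by
  unfold W2sq
  refine le_iInf₂ fun σ hσ => ?_
  refine iInf₂_le_of_le (σ.map Prod.swap) ⟨?_, ?_⟩ ?_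
  · rw [Measure.map_map measurable_fst measurable_swap]; exact hσ.2
  · rw [Measure.map_map measurable_snd measurable_swap]; exact hσ.1
  · rw [lintegral_map (by fun_prop) measurable_swap]
    refine le_of_eq (lintegral_congr fun p => ?_)
    simp only [Prod.fst_swap, Prod.snd_swap]
    rw [← nnnorm_neg, neg_sub]

theorem W2sq_closed_le {E : Type*} [MeasurableSpace E] [NormedAddCommGroup E] [BorelSpace E]
    [SecondCountableTopology E] (μ ν : Measure E) [IsFiniteMeasure ν] (h0 : W2sq μ ν = 0)
    (F : Set E) (hF : IsClosed F) : μ F ≤ ν F := by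
  have key : ∀ δ : ℝ, 0 < δ → μ F ≤ ν (Metric.cthickening δ F) := by
    intro δ hδ
    have hδ' : (ENNReal.ofReal δ) ^ 2 ≠ 0 := by positivity
    have hδt : (ENNReal.ofReal δ) ^ 2 ≠ ⊤ := by finiteness
    refine ENNReal.le_of_forall_pos_le_add fun ε hε _ => ?_
    have hlt : W2sq μ ν < (ε : ENNReal) * (ENNReal.ofReal δ) ^ 2 := by
      rw [h0]; positivity
    unfold W2sq at hlt
    simp only [iInf_lt_iff] at hlt
    obtain ⟨σ, ⟨h1, h2⟩, hc⟩ := hlt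
    rw [← h1, ← h2, Measure.map_apply measurable_fst hF.measurableSet,
      Measure.map_apply measurable_snd Metric.isClosed_cthickening.measurableSet]
    have hsub : Prod.fst ⁻¹' F ⊆ (Prod.snd ⁻¹' (Metric.cthickening δ F)) ∪
        {p : E × E | (ENNReal.ofReal δ) ^ 2 ≤ (‖p.1 - p.2‖₊ : ENNReal) ^ 2} := by
      intro p hp
      by_cases hd : dist p.2 p.1 ≤ δ
      · left
        exact Metric.mem_cthickening_of_dist_le _ _ _ _ hp hd
      · right
        push Not at hd
        simp only [Set.mem_setOf_eq]
        gcongr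
        rw [dist_comm, dist_eq_norm] at hd
        have := ENNReal.ofReal_le_ofReal hd.le
        rwa [ofReal_norm_eq_enorm] at this
    refine (measure_mono hsub).trans ((measure_union_le _ _).trans ?_)
    gcongr
    refine (meas_ge_le_lintegral_div (by fun_prop) hδ' hδt).trans ?_
    exact ENNReal.div_le_of_le_mul hc.le
  have ht := tendsto_measure_cthickening_of_isClosed (μ := ν) (s := F)
    ⟨1, one_pos, measure_ne_top _ _⟩ hF
  refine ge_of_tendsto (ht.mono_left (nhdsWithin_le_nhds (s := Set.Ioi 0))) ?_
  filter_upwards [self_mem_nhdsWithin] with δ hδ using key δ hδ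

theorem W2sq_eq_zero {E : Type*} [MeasurableSpace E] [NormedAddCommGroup E] [BorelSpace E]
    [SecondCountableTopology E] (μ ν : Measure E) [IsProbabilityMeasure μ]
    [IsProbabilityMeasure ν] (h0 : W2sq μ ν = 0) : μ = ν := by
  have h0' : W2sq ν μ = 0 := le_antisymm ((W2sq_swap_le μ ν).trans h0.le) bot_le
  refine ext_of_generate_finite {s : Set E | IsClosed s} ?_ isPiSystem_isClosed ?_ (by simp)
  · rw [← borel_eq_generateFrom_isClosed]; exact BorelSpace.measurable_eq
  · intro F hF
    exact le_antisymm (W2sq_closed_le μ ν h0 F hF) (W2sq_closed_le ν μ h0' F hF)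

theorem convex_grad_ineq {d : ℕ} (V : EuclideanSpace ℝ (Fin d) → ℝ)
    (hV : Differentiable ℝ V) (hconv : ConvexOn ℝ Set.univ V)
    (x y : EuclideanSpace ℝ (Fin d)) :
    V x + inner ℝ (gradient V x) (y - x) ≤ V y := by
  have hg : HasFDerivAt V (fderiv ℝ V x) x := (hV x).hasFDerivAt
  have hi : inner ℝ (gradient V x) (y - x) = fderiv ℝ V x (y - x) := by
    simp [gradient]
  have hl : HasDerivAt (fun t : ℝ => V (x + t • (y - x))) (fderiv ℝ V x (y - x)) 0 := by
    have h1 : HasDerivAt (fun t : ℝ => x + t • (y - x)) (y - x) 0 := by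
      simpa using ((hasDerivAt_id (0 : ℝ)).smul_const (y - x)).const_add x
    have h2 : HasFDerivAt V (fderiv ℝ V x) (x + (0 : ℝ) • (y - x)) := by simpa using hg
    exact h2.comp_hasDerivAt (0 : ℝ) h1
  have hc : ConvexOn ℝ Set.univ (fun t : ℝ => V (x + t • (y - x))) := by
    have := hconv.comp_affineMap (AffineMap.lineMap (k := ℝ) x y)
    simp only [Set.preimage_univ] at this
    convert! this using 2 with t
    simp [AffineMap.lineMap_apply, add_comm]
  have := hc.le_slope_of_hasDerivAt (Set.mem_univ 0) (Set.mem_univ 1) one_pos hl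
  simp [slope_def_field] at this
  rw [hi]; simp; linarith

theorem prox_ineq {d : ℕ} (V : EuclideanSpace ℝ (Fin d) → ℝ)
    (hV : Differentiable ℝ V) (hconv : ConvexOn ℝ Set.univ V) (h : ℝ) (hh : 0 < h)
    (x j y : EuclideanSpace ℝ (Fin d)) (hj : j + h • gradient V j = x) :
    V j + (1 / (2 * h)) * ‖x - j‖ ^ 2 + (1 / (2 * h)) * ‖j - y‖ ^ 2
      ≤ V y + (1 / (2 * h)) * ‖x - y‖ ^ 2 := by
  have h1 := convex_grad_ineq V hV hconv j y
  have h2 : ‖x - y‖ ^ 2 = ‖x - j‖ ^ 2 - 2 * (h * inner ℝ (gradient V j) (y - j)) + ‖j - y‖ ^ 2 := by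
    have e1 : x - y = (x - j) - (y - j) := by abel
    have e2 : x - j = h • gradient V j := by rw [← hj]; abel
    rw [e1, norm_sub_sq_real, norm_sub_rev j y]
    congr 3
    rw [e2, real_inner_smul_left]
  rw [h2]
  have : (1 / (2 * h)) * (2 * (h * inner ℝ (gradient V j) (y - j))) = inner ℝ (gradient V j) (y - j) := by
    field_simp
  nlinarith

theorem V_integrable {d : ℕ} (V : EuclideanSpace ℝ (Fin d) → ℝ)
    (hV : ContDiff ℝ 2 V) (hconv : ConvexOn ℝ Set.univ V)
    (hhess : ∃ C : ℝ, ∀ x, ‖fderiv ℝ (gradient V) x‖ ≤ C)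
    (ν : Measure (EuclideanSpace ℝ (Fin d))) [IsProbabilityMeasure ν]
    (hν : Integrable (fun x => ‖x‖ ^ 2) ν) : Integrable V ν := by
  obtain ⟨C, hC⟩ := hhess
  have hd : Differentiable ℝ V := hV.differentiable (by norm_num)
  have hgd : Differentiable ℝ (gradient V) := by
    have h1 : Differentiable ℝ (fderiv ℝ V) :=
      (hV.fderiv_right (m := 1) (by norm_num)).differentiable (by norm_num)
    exact ((InnerProductSpace.toDual ℝ (EuclideanSpace ℝ (Fin d))).symm.toContinuousLinearEquiv.differentiable).comp h1
  set G := ‖gradient V 0‖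
  have hg : ∀ x, ‖gradient V x‖ ≤ G + C * ‖x‖ := by
    intro x
    have := convex_univ.norm_image_sub_le_of_norm_fderiv_le (f := gradient V) (𝕜 := ℝ) (C := C)
      (fun z _ => hgd z) (fun z _ => hC z) (Set.mem_univ 0) (Set.mem_univ x)
    rw [sub_zero] at this
    have h2 := norm_le_norm_add_norm_sub' (gradient V x) (gradient V 0)
    linarith
  have hb : ∀ x, ‖V x‖ ≤ (|V 0| + G) + (G + C) * ‖x‖ ^ 2 := by
    intro x
    have h1 := convex_grad_ineq V hd hconv 0 x
    have h2 := convex_grad_ineq V hd hconv x 0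
    have h3 := abs_real_inner_le_norm (gradient V 0) (x - 0)
    have h4 := abs_real_inner_le_norm (gradient V x) (0 - x)
    simp only [sub_zero, zero_sub, norm_neg] at h1 h2 h3 h4
    have hx := norm_nonneg x
    have hG : 0 ≤ G := norm_nonneg _
    have hC0 : 0 ≤ C := (norm_nonneg _).trans (hC 0)
    have h5 := mul_le_mul_of_nonneg_right (hg x) hx
    have h6 : G * ‖x‖ ≤ G * (1 + ‖x‖ ^ 2) := by
      gcongr; nlinarith [sq_nonneg (‖x‖ - 1)]
    have h7 : 0 ≤ C * ‖x‖ ^ 2 := by positivity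
    have h3' : |inner ℝ (gradient V 0) x| ≤ G * ‖x‖ := h3
    rw [Real.norm_eq_abs, abs_le]
    constructor
    · have := neg_abs_le (V 0); have := (abs_le.1 h3').1
      nlinarith
    · have := le_abs_self (V 0); have := (abs_le.1 h4).1
      nlinarith
  exact ((integrable_const _).add (hν.const_mul _)).mono' hV.continuous.aestronglyMeasurable
    (ae_of_all _ hb)

theorem J_bound {d : ℕ} (V : EuclideanSpace ℝ (Fin d) → ℝ)
    (hV : Differentiable ℝ V) (hconv : ConvexOn ℝ Set.univ V) (h : ℝ) (hh : 0 < h)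
    (x j : EuclideanSpace ℝ (Fin d)) (hj : j + h • gradient V j = x) :
    ‖j‖ ≤ ‖x‖ + h * ‖gradient V 0‖ := by
  have h1 := convex_grad_ineq V hV hconv 0 j
  have h2 := convex_grad_ineq V hV hconv j 0
  simp only [sub_zero, zero_sub, inner_neg_right] at h1 h2
  have h3 : inner ℝ x j = ‖j‖ ^ 2 + h * inner ℝ (gradient V j) j := by
    rw [← hj, inner_add_left, real_inner_smul_left, real_inner_self_eq_norm_sq]
  have h4 := real_inner_le_norm x j
  have h5 := (abs_le.1 (abs_real_inner_le_norm (gradient V 0) j)).1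
  have h6 : h * inner ℝ (gradient V 0) j ≤ h * inner ℝ (gradient V j) j := by
    gcongr; linarith
  have h7 := mul_le_mul_of_nonneg_left h5 hh.le
  have h8 : ‖j‖ * ‖j‖ ≤ (‖x‖ + h * ‖gradient V 0‖) * ‖j‖ := by nlinarith
  rcases (norm_nonneg j).eq_or_lt with h0 | h0
  · rw [← h0]; positivity
  · exact le_of_mul_le_mul_right h8 h0

theorem coupling_sq_integrable {d : ℕ} (μ ν : Measure (EuclideanSpace ℝ (Fin d)))
    (hμ : Integrable (fun x => ‖x‖ ^ 2) μ) (hν : Integrable (fun x => ‖x‖ ^ 2) ν)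
    (σ : Measure (EuclideanSpace ℝ (Fin d) × EuclideanSpace ℝ (Fin d)))
    (h1 : σ.map Prod.fst = μ) (h2 : σ.map Prod.snd = ν) :
    Integrable (fun p => ‖p.1 - p.2‖ ^ 2) σ := by
  subst h1; subst h2
  have i1 := hμ.comp_measurable measurable_fst
  have i2 := hν.comp_measurable measurable_snd
  refine ((i1.const_mul 2).add (i2.const_mul 2)).mono' (by fun_prop) (ae_of_all _ fun p => ?_)
  simp only [Function.comp, Pi.add_apply]
  rw [Real.norm_of_nonneg (by positivity)]
  have := norm_sub_le p.1 p.2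
  nlinarith [sq_nonneg (‖p.1‖ - ‖p.2‖), norm_nonneg (p.1 - p.2), norm_nonneg p.1, norm_nonneg p.2]

theorem coupling_cost {d : ℕ}
    (σ : Measure (EuclideanSpace ℝ (Fin d) × EuclideanSpace ℝ (Fin d)))
    (hi : Integrable (fun p => ‖p.1 - p.2‖ ^ 2) σ) :
    ∫⁻ p, (‖p.1 - p.2‖₊ : ENNReal) ^ 2 ∂σ = ENNReal.ofReal (∫ p, ‖p.1 - p.2‖ ^ 2 ∂σ) := by
  rw [ofReal_integral_eq_lintegral_ofReal hi (ae_of_all _ fun p => by positivity)]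
  refine lintegral_congr fun p => ?_
  rw [ENNReal.ofReal_pow (norm_nonneg _), ofReal_norm_eq_enorm]; rfl

theorem W2sq_le_of_coupling {d : ℕ} (μ ν : Measure (EuclideanSpace ℝ (Fin d)))
    (hμ : Integrable (fun x => ‖x‖ ^ 2) μ) (hν : Integrable (fun x => ‖x‖ ^ 2) ν)
    (σ : Measure (EuclideanSpace ℝ (Fin d) × EuclideanSpace ℝ (Fin d)))
    (h1 : σ.map Prod.fst = μ) (h2 : σ.map Prod.snd = ν) :
    W2sq μ ν ≠ ⊤ ∧ (W2sq μ ν).toReal ≤ ∫ p, ‖p.1 - p.2‖ ^ 2 ∂σ := by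
  have hle : W2sq μ ν ≤ ENNReal.ofReal (∫ p, ‖p.1 - p.2‖ ^ 2 ∂σ) := by
    rw [← coupling_cost σ (coupling_sq_integrable μ ν hμ hν σ h1 h2)]
    exact iInf₂_le σ ⟨h1, h2⟩
  exact ⟨ne_top_of_le_ne_top ENNReal.ofReal_ne_top hle,
    ENNReal.toReal_le_of_le_ofReal (integral_nonneg fun p => by positivity) hle⟩

theorem le_W2sq {d : ℕ} (μ ν : Measure (EuclideanSpace ℝ (Fin d)))
    [IsProbabilityMeasure μ] [IsProbabilityMeasure ν]
    (hμ : Integrable (fun x => ‖x‖ ^ 2) μ) (hν : Integrable (fun x => ‖x‖ ^ 2) ν) (K : ℝ)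
    (hK : ∀ σ : Measure (EuclideanSpace ℝ (Fin d) × EuclideanSpace ℝ (Fin d)),
      σ.map Prod.fst = μ → σ.map Prod.snd = ν → K ≤ ∫ p, ‖p.1 - p.2‖ ^ 2 ∂σ) :
    W2sq μ ν ≠ ⊤ ∧ K ≤ (W2sq μ ν).toReal := by
  have hf : W2sq μ ν ≠ ⊤ := (W2sq_le_of_coupling μ ν hμ hν (μ.prod ν)
    (by simp [Measure.map_fst_prod]) (by simp [Measure.map_snd_prod])).1
  refine ⟨hf, (ENNReal.ofReal_le_iff_le_toReal hf).1 ?_⟩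
  refine le_iInf₂ fun σ hσ => ?_
  rw [coupling_cost σ (coupling_sq_integrable μ ν hμ hν σ hσ.1 hσ.2)]
  exact ENNReal.ofReal_le_ofReal (hK σ hσ.1 hσ.2)

theorem key_ineq {d : ℕ} (V : EuclideanSpace ℝ (Fin d) → ℝ)
    (hV : ContDiff ℝ 2 V) (hconv : ConvexOn ℝ Set.univ V)
    (hhess : ∃ C : ℝ, ∀ x, ‖fderiv ℝ (gradient V) x‖ ≤ C)
    (h : ℝ) (hh : 0 < h)
    (J : EuclideanSpace ℝ (Fin d) → EuclideanSpace ℝ (Fin d))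
    (hJm : Measurable J)
    (hJ : ∀ x, J x + h • gradient V (J x) = x)
    (μ : Measure (EuclideanSpace ℝ (Fin d))) [IsProbabilityMeasure μ]
    (hμ2 : Integrable (fun x => ‖x‖ ^ 2) μ)
    (hJ2 : Integrable (fun x => ‖x‖ ^ 2) (μ.map J))
    (ν : Measure (EuclideanSpace ℝ (Fin d))) [IsProbabilityMeasure ν]
    (hν2 : Integrable (fun x => ‖x‖ ^ 2) ν) :
    W2sq (μ.map J) ν ≠ ⊤ ∧
    (∫ x, V x ∂(μ.map J)) + (1 / (2 * h)) * (W2sq μ (μ.map J)).toReal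
        + (1 / (2 * h)) * (W2sq (μ.map J) ν).toReal
        ≤ (∫ x, V x ∂ν) + (1 / (2 * h)) * (W2sq μ ν).toReal := by
  have hJp : IsProbabilityMeasure (μ.map J) := Measure.isProbabilityMeasure_map hJm.aemeasurable
  have hd : Differentiable ℝ V := hV.differentiable (by norm_num)
  refine ⟨(le_W2sq (μ.map J) ν hJ2 hν2 0 fun σ _ _ =>
    integral_nonneg fun p => by positivity).1, ?_⟩
  have hc : 0 < 1 / (2 * h) := by positivity
  have main := (le_W2sq μ ν hμ2 hν2 ((2 * h) * ((∫ x, V x ∂(μ.map J))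
        + (1 / (2 * h)) * (W2sq μ (μ.map J)).toReal
        + (1 / (2 * h)) * (W2sq (μ.map J) ν).toReal - ∫ x, V x ∂ν)) ?_).2
  · have := mul_le_mul_of_nonneg_left main hc.le
    rw [← mul_assoc, show 1 / (2 * h) * (2 * h) = 1 by field_simp] at this
    linarith
  intro σ h1 h2
  have hmJ : Measurable fun p : EuclideanSpace ℝ (Fin d) × EuclideanSpace ℝ (Fin d) => J p.1 :=
    hJm.comp measurable_fst
  -- the coupling of `μ` and `J_# μ`, and that of `J_# μ` and `ν`, induced by `σ`
  have hA1 : (σ.map fun p => (p.1, J p.1)).map Prod.fst = μ := by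
    rw [Measure.map_map measurable_fst (measurable_fst.prodMk hmJ)]; exact h1
  have hA2 : (σ.map fun p => (p.1, J p.1)).map Prod.snd = μ.map J := by
    rw [Measure.map_map measurable_snd (measurable_fst.prodMk hmJ), ← h1,
      Measure.map_map hJm measurable_fst]; rfl
  have hB1 : (σ.map fun p => (J p.1, p.2)).map Prod.fst = μ.map J := by
    rw [Measure.map_map measurable_fst (hmJ.prodMk measurable_snd), ← h1,
      Measure.map_map hJm measurable_fst]; rfl
  have hB2 : (σ.map fun p => (J p.1, p.2)).map Prod.snd = ν := by
    rw [Measure.map_map measurable_snd (hmJ.prodMk measurable_snd)]; exact h2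
  have wA := (W2sq_le_of_coupling _ _ hμ2 hJ2 _ hA1 hA2).2
  have wB := (W2sq_le_of_coupling _ _ hJ2 hν2 _ hB1 hB2).2
  have iA := (coupling_sq_integrable _ _ hμ2 hJ2 _ hA1 hA2).comp_measurable
    (measurable_fst.prodMk hmJ)
  have iB := (coupling_sq_integrable _ _ hJ2 hν2 _ hB1 hB2).comp_measurable
    (hmJ.prodMk measurable_snd)
  have iC := coupling_sq_integrable _ _ hμ2 hν2 _ h1 h2
  rw [integral_map (measurable_fst.prodMk hmJ).aemeasurable (by fun_prop)] at wA
  rw [integral_map (hmJ.prodMk measurable_snd).aemeasurable (by fun_prop)] at wB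
  have iVJ := V_integrable V hV hconv hhess _ hJ2
  have iVν := V_integrable V hV hconv hhess _ hν2
  have eJ : μ.map J = σ.map fun p => J p.1 := by
    rw [← h1, Measure.map_map hJm measurable_fst]; rfl
  have vJ : ∫ x, V x ∂(μ.map J) = ∫ p, V (J p.1) ∂σ := by
    rw [eJ, integral_map hmJ.aemeasurable hV.continuous.aestronglyMeasurable]
  have vν : ∫ x, V x ∂ν = ∫ p, V p.2 ∂σ := by
    rw [← h2, integral_map measurable_snd.aemeasurable hV.continuous.aestronglyMeasurable]
  rw [eJ] at iVJ
  rw [← h2] at iVν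
  have jJ := iVJ.comp_measurable hmJ
  have jν := iVν.comp_measurable measurable_snd
  have hmono := integral_mono ((jJ.add (iA.const_mul (1 / (2 * h)))).add
    (iB.const_mul (1 / (2 * h)))) (jν.add (iC.const_mul (1 / (2 * h))))
    (fun p => prox_ineq V hd hconv h hh p.1 (J p.1) p.2 (hJ p.1))
  rw [integral_add' (jJ.add (iA.const_mul (1 / (2 * h)))) (iB.const_mul (1 / (2 * h))),
    integral_add' jJ (iA.const_mul (1 / (2 * h))), integral_add' jν (iC.const_mul (1 / (2 * h))),
    integral_const_mul, integral_const_mul, integral_const_mul] at hmono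
  simp only [Function.comp_def] at hmono
  rw [vJ, vν]
  have k1 := mul_le_mul_of_nonneg_left wA hc.le
  have k2 := mul_le_mul_of_nonneg_left wB hc.le
  set X := ∫ p, ‖p.1 - p.2‖ ^ 2 ∂σ
  have : X = (2 * h) * (1 / (2 * h) * X) := by field_simp
  rw [this]
  gcongr
  linarith

/-- For convex `V ∈ C²` with bounded Hessian and `J = (I + h ∇V)⁻¹`, the pushforward
`J_# μ` is the unique minimizer over `P₂(ℝ^d)` of `ν ↦ ∫ V dν + (1/(2h)) W₂²(μ,ν)`. -/
theorem stmt12 {d : ℕ} (V : EuclideanSpace ℝ (Fin d) → ℝ)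
    (hV : ContDiff ℝ 2 V) (hconv : ConvexOn ℝ Set.univ V)
    (hhess : ∃ C : ℝ, ∀ x, ‖fderiv ℝ (gradient V) x‖ ≤ C)
    (h : ℝ) (hh : 0 < h)
    (J : EuclideanSpace ℝ (Fin d) → EuclideanSpace ℝ (Fin d))
    (hJm : Measurable J)
    (hJ : ∀ x, J x + h • gradient V (J x) = x)
    (μ : Measure (EuclideanSpace ℝ (Fin d)))
    (hμp : IsProbabilityMeasure μ) (hμ2 : Integrable (fun x => ‖x‖ ^ 2) μ) :
    (∀ ν : Measure (EuclideanSpace ℝ (Fin d)),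
      IsProbabilityMeasure ν → Integrable (fun x => ‖x‖ ^ 2) ν →
      (∫ x, V x ∂(μ.map J)) + (1 / (2 * h)) * (W2sq μ (μ.map J)).toReal
        ≤ (∫ x, V x ∂ν) + (1 / (2 * h)) * (W2sq μ ν).toReal)
    ∧ (∀ ν : Measure (EuclideanSpace ℝ (Fin d)),
      IsProbabilityMeasure ν → Integrable (fun x => ‖x‖ ^ 2) ν →
      (∀ ν' : Measure (EuclideanSpace ℝ (Fin d)),
        IsProbabilityMeasure ν' → Integrable (fun x => ‖x‖ ^ 2) ν' →
        (∫ x, V x ∂ν) + (1 / (2 * h)) * (W2sq μ ν).toReal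
          ≤ (∫ x, V x ∂ν') + (1 / (2 * h)) * (W2sq μ ν').toReal) →
      ν = μ.map J) := by
  have hd : Differentiable ℝ V := hV.differentiable (by norm_num)
  have hJp : IsProbabilityMeasure (μ.map J) := Measure.isProbabilityMeasure_map hJm.aemeasurable
  have hJ2 : Integrable (fun x => ‖x‖ ^ 2) (μ.map J) := by
    rw [integrable_map_measure (by fun_prop) hJm.aemeasurable]
    refine ((hμ2.const_mul 2).add (integrable_const (2 * (h * ‖gradient V 0‖) ^ 2))).mono'
      (by fun_prop) (ae_of_all _ fun x => ?_)
    have hb := J_bound V hd hconv h hh x (J x) (hJ x)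
    simp only [Function.comp, Pi.add_apply]
    rw [Real.norm_of_nonneg (by positivity)]
    have := pow_le_pow_left₀ (norm_nonneg _) hb 2
    nlinarith [sq_nonneg (‖x‖ - h * ‖gradient V 0‖)]
  have hc : 0 < 1 / (2 * h) := by positivity
  have key := fun (ν : Measure (EuclideanSpace ℝ (Fin d))) (hν : IsProbabilityMeasure ν)
    (hν2 : Integrable (fun x => ‖x‖ ^ 2) ν) =>
    key_ineq V hV hconv hhess h hh J hJm hJ μ hμ2 hJ2 ν hν2
  refine ⟨fun ν hν hν2 => ?_, fun ν hν hν2 hmin => ?_⟩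
  · have h1 := (key ν hν hν2).2
    have h2 : 0 ≤ (1 / (2 * h)) * (W2sq (μ.map J) ν).toReal := by positivity
    linarith
  · obtain ⟨hf, h1⟩ := key ν hν hν2
    have h2 := hmin _ hJp hJ2
    have h3 : (1 / (2 * h)) * (W2sq (μ.map J) ν).toReal ≤ 0 := by linarith
    have h4 : (W2sq (μ.map J) ν).toReal = 0 :=
      le_antisymm (nonpos_of_mul_nonpos_right h3 hc) ENNReal.toReal_nonneg
    have h5 : W2sq (μ.map J) ν = 0 := by
      rcases (ENNReal.toReal_eq_zero_iff _).1 h4 with h6 | h6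
      · exact h6
      · exact absurd h6 hf
    exact (W2sq_eq_zero _ _ h5).symm
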